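/- arXiv:0710.2282 — 2 statements merged into one kernel-verified Lean document; each statement's English description precedes it below -/
import Mathlib

section
/- Suppose the crossed-product conditions (C1)–(C5) hold, R carries an involution r ↦ r̄, and w : G → R satisfies the w-conditions (W1)–(W4) (so each w(g) is a unit of R). For a left R-module P let P* = Hom_R(P,R) with left R-action (r·f)(x) = f(x)·r̄, and let res_{c_g} denote restriction of scalars along c_g. Then for every g ∈ G and every left R-module P, the map t_g(P) : res_{c_g}(P*) → (res_{c_g}P)* sending f to the function p ↦ c_g⁻¹(f(p))·(w(g)·τ(g⁻¹,g))⁻¹ is well defined (each t_g(P)(f) is an R-linear map res_{c_g}P → R), is itself an R-linear bijection, and is natural in P (for every R-linear q : P → Q one has t_g(P) ∘ res_{c_g}(q*) = (res_{c_g}q)* ∘ t_g(Q), where q* is the dual map). -/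
universe u v

variable {R : Type u} [Ring R] {G : Type v} [Group G]

/-- (C1): `c_{τ(g,g')} ∘ c_{gg'} = c_g ∘ c_{g'}`, where `c_u` is conjugation by the unit `u`. -/
def CondC1 (c : G → R ≃+* R) (τ : G → G → Rˣ) : Prop :=
  ∀ (g g' : G) (r : R),
    (τ g g' : R) * c (g * g') r * (((τ g g')⁻¹ : Rˣ) : R) = c g (c g' r)

/-- (C2): `τ(g,g')·τ(gg',g'') = c_g(τ(g',g''))·τ(g,g'g'')`. -/
def CondC2 (c : G → R ≃+* R) (τ : G → G → Rˣ) : Prop :=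
  ∀ g g' g'' : G,
    (τ g g' : R) * ((τ (g * g') g'' : Rˣ) : R) =
      c g ((τ g' g'' : Rˣ) : R) * ((τ g (g' * g'') : Rˣ) : R)

/-- (C3): `c_e = id`. -/
def CondC3 (c : G → R ≃+* R) : Prop := c (1 : G) = RingEquiv.refl R

/-- (C4): `τ(e,g) = 1`. -/
def CondC4 (τ : G → G → Rˣ) : Prop := ∀ g : G, τ 1 g = 1

/-- (C5): `τ(g,e) = 1`. -/
def CondC5 (τ : G → G → Rˣ) : Prop := ∀ g : G, τ g 1 = 1


/-- A ring involution: `σ 1 = 1`, `σ` is additive, anti-multiplicative and of order two. -/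
def IsRingInvolution (σ : R → R) : Prop :=
  σ 1 = 1 ∧ (∀ a b : R, σ (a + b) = σ a + σ b) ∧
    (∀ a b : R, σ (a * b) = σ b * σ a) ∧ ∀ a : R, σ (σ a) = a

/-- (W1): `w(e) = 1`. -/
def CondW1 (w : G → R) : Prop := w (1 : G) = 1

/-- (W2): `w(gh) = w(h)·c_{h⁻¹}(w(g))·τ(h⁻¹,g⁻¹)·c_{(gh)⁻¹}(τ(g,h)‾)⁻¹`
(the last factor is the ring inverse of `c_{(gh)⁻¹}(σ(τ(g,h)))`, taken via `Ring.inverse`). -/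
def CondW2 (σ : R → R) (c : G → R ≃+* R) (τ : G → G → Rˣ) (w : G → R) : Prop :=
  ∀ g h : G,
    w (g * h) =
      w h * c h⁻¹ (w g) * ((τ h⁻¹ g⁻¹ : Rˣ) : R) *
        Ring.inverse (c (g * h)⁻¹ (σ ((τ g h : Rˣ) : R)))

/-- (W3): `σ(w(g)) = w(g)·c_g⁻¹(τ(g,g⁻¹)·(σ(τ(g,g⁻¹)))⁻¹)`, where `c_g⁻¹` is the inverse
automorphism of `c_g`. -/
def CondW3 (σ : R → R) (c : G → R ≃+* R) (τ : G → G → Rˣ) (w : G → R) : Prop :=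
  ∀ g : G,
    σ (w g) =
      w g * (c g).symm (((τ g g⁻¹ : Rˣ) : R) * Ring.inverse (σ ((τ g g⁻¹ : Rˣ) : R)))

/-- (W4): `σ(c_g(r)) = c_g((w(g)·τ(g⁻¹,g))⁻¹ · σ(r) · (w(g)·τ(g⁻¹,g)))`. -/
def CondW4 (σ : R → R) (c : G → R ≃+* R) (τ : G → G → Rˣ) (w : G → R) : Prop :=
  ∀ (g : G) (r : R),
    σ (c g r) =
      c g (Ring.inverse (w g * ((τ g⁻¹ g : Rˣ) : R)) * σ r *
        (w g * ((τ g⁻¹ g : Rˣ) : R)))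

/-- The candidate involution on the crossed product:
`Σ_g r_g·g ↦ Σ_g (w(g)·c_{g⁻¹}(σ(r_g)))·g⁻¹`. -/
noncomputable def crossedStar (σ : R → R) (c : G → R ≃+* R) (w : G → R)
    (x : G →₀ R) : G →₀ R :=
  x.sum fun g r => Finsupp.single g⁻¹ (w g * c g⁻¹ (σ r))

universe w

/-- The map `t_g(P) : res_{c_g}(P*) → (res_{c_g}P)*` (on underlying functions):
`f ↦ (p ↦ c_g⁻¹(f(p))·(w(g)·τ(g⁻¹,g))⁻¹)`, the inverse being taken via `Ring.inverse`. -/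
noncomputable def tMap (c : G → R ≃+* R) (τ : G → G → Rˣ) (w : G → R) (g : G)
    {P : Type w} [AddCommGroup P] [Module R P] (f : P →ₗ[R] R) (p : P) : R :=
  (c g).symm (f p) * Ring.inverse (w g * ((τ g⁻¹ g : Rˣ) : R))

theorem IsRingInvolution.isUnit {σ : R → R} (hσ : IsRingInvolution σ) {a : R} (ha : IsUnit a) :
    IsUnit (σ a) := by
  obtain ⟨hone, -, hmul, -⟩ := hσ
  obtain ⟨u, rfl⟩ := ha
  exact ⟨⟨σ u, σ (u⁻¹ : Rˣ), by rw [← hmul, Units.inv_mul, hone],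
    by rw [← hmul, Units.mul_inv, hone]⟩, rfl⟩

/-- (W1) and (W2) force every value of `w` to be a unit. -/
theorem isUnit_of_condW2 {c : G → R ≃+* R} {τ : G → G → Rˣ} {σ : R → R} {w : G → R}
    (hσ : IsRingInvolution σ) (hw1 : CondW1 w) (hw2 : CondW2 σ c τ w) (g : G) :
    IsUnit (w g) := by
  have key : ∀ g : G, ∃ u : Rˣ, w g⁻¹ * c g (w g) * u = 1 := fun g => by
    have hu : IsUnit (((τ g g⁻¹ : Rˣ) : R) *
        Ring.inverse (c (g * g⁻¹)⁻¹ (σ ((τ g g⁻¹ : Rˣ) : R)))) :=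
      (τ g g⁻¹).isUnit.mul ((hσ.isUnit (τ g g⁻¹).isUnit).map (c (g * g⁻¹)⁻¹)).ringInverse
    obtain ⟨u, hu⟩ := hu
    refine ⟨u, ?_⟩
    have h := hw2 g g⁻¹
    rw [mul_assoc, inv_inv, ← hu, mul_inv_cancel, hw1] at h
    exact h.symm
  obtain ⟨u, hu⟩ := key g
  obtain ⟨v, hv⟩ := key g⁻¹
  rw [inv_inv, mul_assoc] at hv
  have hleft : (u * w g⁻¹) * c g (w g) = 1 := by
    rw [mul_assoc, Units.mul_eq_one_iff_inv_eq, ← Units.mul_eq_one_iff_eq_inv.mp hu]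
  refine isUnit_iff_exists_and_exists.mpr ⟨⟨_, hv⟩, (c g).symm (u * w g⁻¹), ?_⟩
  simpa using congrArg (c g).symm hleft

/-- under (C1)–(C5), an involution `σ` of `R` and the `w`-conditions (W1)–(W4)
(so each `w(g)` is a unit), for every `g ∈ G` and every left `R`-module `P`, with
`P* = Hom_R(P,R)` carrying the action `(r·f)(x) = f(x)·σ(r)`:
the map `t_g(P) : f ↦ (p ↦ c_g⁻¹(f(p))·(w(g)·τ(g⁻¹,g))⁻¹)` is well defined (each `t_g(P)(f)`
is additive and `R`-linear as a map `res_{c_g}P → R`), is itself additive and `R`-linear for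
the twisted dual actions, is a bijection onto the `c_g⁻¹`-semilinear functionals on `P`,
and is natural in `P`. -/
theorem tMap_is_natural_linear_iso
    (c : G → R ≃+* R) (τ : G → G → Rˣ) (σ : R → R) (w : G → R)
    (hσ : IsRingInvolution σ)
    (h1 : CondC1 c τ) (h2 : CondC2 c τ) (h3 : CondC3 c) (h4 : CondC4 τ) (h5 : CondC5 τ)
    (hw1 : CondW1 w) (hw2 : CondW2 σ c τ w) (hw3 : CondW3 σ c τ w) (hw4 : CondW4 σ c τ w) :
    ∀ (P : Type w) [AddCommGroup P] [Module R P] (g : G),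
      -- `t_g(P)(f)` is `R`-linear as a map `res_{c_g}P → R`
      (∀ f : P →ₗ[R] R,
        (∀ p p' : P, tMap c τ w g f (p + p') = tMap c τ w g f p + tMap c τ w g f p') ∧
        (∀ (r : R) (p : P), tMap c τ w g f (c g r • p) = r * tMap c τ w g f p)) ∧
      -- `t_g(P)` is additive
      (∀ (f f' : P →ₗ[R] R) (p : P),
        tMap c τ w g (f + f') p = tMap c τ w g f p + tMap c τ w g f' p) ∧
      -- `t_g(P)` intertwines the dual `R`-actions: `t_g((c_g(r))·f) = r·(t_g(f))`,
      -- where `((c_g(r))·f)(x) = f(x)·σ(c_g(r))` and `(r·F)(p) = F(p)·σ(r)`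
      (∀ (r : R) (f : P →ₗ[R] R) (p : P),
        (c g).symm (f p * σ (c g r)) * Ring.inverse (w g * ((τ g⁻¹ g : Rˣ) : R)) =
          tMap c τ w g f p * σ r) ∧
      -- `t_g(P)` is a bijection from `P*` onto the semilinear functionals on `res_{c_g}P`
      (∀ φ : P → R,
        (∀ p p' : P, φ (p + p') = φ p + φ p') →
        (∀ (r : R) (p : P), φ (r • p) = (c g).symm r * φ p) →
        ∃! f : P →ₗ[R] R, ∀ p : P, tMap c τ w g f p = φ p) ∧
      -- naturality: `t_g(P) ∘ res_{c_g}(q*) = (res_{c_g}q)* ∘ t_g(Q)` for `R`-linear `q`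
      (∀ (Q : Type w) [AddCommGroup Q] [Module R Q] (q : P →ₗ[R] Q)
          (F : Q →ₗ[R] R) (p : P),
        tMap c τ w g (F.comp q) p = tMap c τ w g F (q p)) := by
  intro P _ _ g
  obtain ⟨v, hv⟩ : IsUnit (w g * ((τ g⁻¹ g : Rˣ) : R)) :=
    (isUnit_of_condW2 hσ hw1 hw2 g).mul (τ g⁻¹ g).isUnit
  have hσc : ∀ r : R, σ (c g r) = c g (((v⁻¹ : Rˣ) : R) * σ r * v) := fun r => by
    simpa only [← hv, Ring.inverse_unit] using hw4 g r
  simp only [tMap, ← hv, Ring.inverse_unit]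
  refine ⟨fun f => ⟨fun p p' => ?_, fun r p => ?_⟩, fun f f' p => ?_, fun r f p => ?_,
    fun φ hadd hsmul => ?_, fun Q _ _ q F p => rfl⟩
  · rw [map_add, map_add, add_mul]
  · rw [map_smul, smul_eq_mul, map_mul, RingEquiv.symm_apply_apply, mul_assoc]
  · rw [LinearMap.add_apply, map_add, add_mul]
  · rw [hσc, map_mul, RingEquiv.symm_apply_apply]
    simp only [mul_assoc, Units.mul_inv, mul_one]
  · refine ⟨{ toFun := fun p => c g (φ p * v), map_add' := ?_, map_smul' := ?_ }, ?_, ?_⟩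
    · intro p p'
      rw [hadd, add_mul, map_add]
    · intro r p
      simp [hsmul, mul_assoc]
    · intro p
      simp
    · intro f hf
      ext p
      simp [← hf p, mul_assoc, -map_mul]
end

section
/- Suppose the crossed-product conditions (C1)–(C5) hold; write S = R∗_{c,τ}G, regard R as a subring of S via r ↦ r·e, and for a left R-module M form the induced left S-module S⊗_R M. Let M, N, P be left R-modules. For a finitely supported family φ = (φ_g)_{g∈G}, where each φ_g : M → N is additive and c_g-semilinear (φ_g(r·x) = c_g(r)·φ_g(x)), the following hold: (a) there is a well-defined S-linear map α(φ) : S⊗_R M → S⊗_R N satisfying α(φ)(u ⊗ x) = Σ_g u·(τ(g⁻¹,g)⁻¹·g⁻¹) ⊗ φ_g(x) for u ∈ S, x ∈ M; (b) if φ_e = id_M and φ_g = 0 for g ≠ e then α(φ) = id; (c) for a second finitely supported family ψ = (ψ_h)_{h∈G} of c_h-semilinear maps N → P, the family χ = (χ_g) defined by χ_g(x) = Σ_{h,k ∈ G, hk = g} τ(h,k)⁻¹·ψ_h(φ_k(x)) consists of c_g-semilinear maps M → P and satisfies α(χ) = α(ψ) ∘ α(φ). -/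
universe u v

variable {R : Type u} [Ring R] {G : Type v} [Group G]

/-- The multiplication of the crossed product `R ∗_{c,τ} G` on the free left `R`-module
`G →₀ R` on `G`: the unique biadditive map with
`(λ·g)·(μ·h) = (λ · c_g(μ) · τ(g,h)) · (gh)`. -/
noncomputable def crossedMul (c : G → R ≃+* R) (τ : G → G → Rˣ) (x y : G →₀ R) : G →₀ R :=
  x.sum fun g r => y.sum fun h s => Finsupp.single (g * h) (r * c g s * ((τ g h : Rˣ) : R))

universe w

/-- The action of the crossed product `S = R ∗_{c,τ} G` on `S ⊗_R M`, where `S ⊗_R M` is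
realised as `G →₀ M` via the identification `(λ·g) ⊗ x = (1·g) ⊗ c_g⁻¹(λ)·x` (the element
`Finsupp.single g x` corresponds to `(1·g) ⊗ x`, and `Finsupp.single 1 x` to `1 ⊗ x`). -/
noncomputable def crossedSMul (c : G → R ≃+* R) (τ : G → G → Rˣ)
    {M : Type w} [AddCommGroup M] [Module R M]
    (u : G →₀ R) (z : G →₀ M) : G →₀ M :=
  u.sum fun g r => z.sum fun h x =>
    Finsupp.single (g * h) (((c (g * h)).symm (r * ((τ g h : Rˣ) : R))) • x)

/-- The characterising property of the map `α(φ) : S ⊗_R M → S ⊗_R N` associated to a family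
`φ = (φ_g)_{g ∈ G}`: it is additive, `S`-linear, and satisfies
`α(φ)(u ⊗ x) = Σ_g u·(τ(g⁻¹,g)⁻¹·g⁻¹) ⊗ φ_g(x)`. -/
def IsInducedHom (c : G → R ≃+* R) (τ : G → G → Rˣ)
    {M N : Type w} [AddCommGroup M] [Module R M] [AddCommGroup N] [Module R N]
    (φ : G → M → N) (A : (G →₀ M) → (G →₀ N)) : Prop :=
  (∀ z z' : G →₀ M, A (z + z') = A z + A z') ∧
  (∀ (u : G →₀ R) (z : G →₀ M), A (crossedSMul c τ u z) = crossedSMul c τ u (A z)) ∧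
  (∀ (u : G →₀ R) (x : M),
    A (crossedSMul c τ u (Finsupp.single (1 : G) x)) =
      ∑ᶠ g : G,
        crossedSMul c τ
          (crossedMul c τ u (Finsupp.single g⁻¹ (((τ g⁻¹ g)⁻¹ : Rˣ) : R)))
          (Finsupp.single (1 : G) (φ g x)))

section CrossedProduct

variable {c : G → R ≃+* R} {τ : G → G → Rˣ} {M N P : Type w} [AddCommGroup M] [Module R M]
  [AddCommGroup N] [Module R N] [AddCommGroup P] [Module R P]

open Finsupp

theorem CondC1.mul_apply (h1 : CondC1 c τ) (g h : G) (r : R) :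
    (τ g h : R) * c (g * h) r = c g (c h r) * (τ g h : R) := by
  rw [← h1, mul_assoc, Units.inv_mul, mul_one]

theorem CondC3.apply_eq (h3 : CondC3 c) (r : R) : c 1 r = r := by
  rw [h3, RingEquiv.refl_apply]

theorem crossedMul_add_left (u v w : G →₀ R) :
    crossedMul c τ (u + v) w = crossedMul c τ u w + crossedMul c τ v w := by
  unfold crossedMul
  refine sum_add_index' (fun g => by simp) fun g r s => ?_
  simp [add_mul, sum_add]

theorem crossedMul_add_right (u v w : G →₀ R) :
    crossedMul c τ u (v + w) = crossedMul c τ u v + crossedMul c τ u w := by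
  unfold crossedMul
  rw [← sum_add]
  refine sum_congr fun g _ => sum_add_index' (fun h => by simp) fun h r s => ?_
  simp [add_mul, mul_add]

theorem crossedMul_single_single (g h : G) (r s : R) :
    crossedMul c τ (single g r) (single h s) = single (g * h) (r * c g s * (τ g h : R)) := by
  simp [crossedMul]

theorem crossedMul_zero_left (u : G →₀ R) : crossedMul c τ 0 u = 0 := by
  simp [crossedMul]

theorem crossedMul_zero_right (u : G →₀ R) : crossedMul c τ u 0 = 0 := by
  simp [crossedMul]

theorem crossedMul_assoc (h1 : CondC1 c τ) (h2 : CondC2 c τ) (u v w : G →₀ R) :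
    crossedMul c τ (crossedMul c τ u v) w = crossedMul c τ u (crossedMul c τ v w) := by
  induction u using Finsupp.induction_linear with
  | zero => simp only [crossedMul_zero_left]
  | add u u' hu hu' => simp only [crossedMul_add_left, hu, hu']
  | single g r =>
  induction v using Finsupp.induction_linear with
  | zero => simp only [crossedMul_zero_left, crossedMul_zero_right]
  | add v v' hv hv' => simp only [crossedMul_add_left, crossedMul_add_right, hv, hv']
  | single h s =>
  induction w using Finsupp.induction_linear with
  | zero => simp only [crossedMul_zero_right]
  | add w w' hw hw' => simp only [crossedMul_add_right, hw, hw']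
  | single k t =>
  simp only [crossedMul_single_single, mul_assoc g h k]
  congr 1
  calc r * c g s * (τ g h : R) * c (g * h) t * (τ (g * h) k : R)
      = r * c g s * ((τ g h : R) * c (g * h) t) * (τ (g * h) k : R) := by noncomm_ring
    _ = r * c g s * c g (c h t) * ((τ g h : R) * (τ (g * h) k : R)) := by
        rw [h1.mul_apply]; noncomm_ring
    _ = _ := by rw [h2]; simp only [map_mul, mul_assoc]

theorem crossedMul_one_left (h3 : CondC3 c) (h4 : CondC4 τ) (u : G →₀ R) :
    crossedMul c τ (single 1 1) u = u := by
  induction u using Finsupp.induction_linear with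
  | zero => exact crossedMul_zero_right _
  | add u v hu hv => rw [crossedMul_add_right, hu, hv]
  | single g r => rw [crossedMul_single_single, h3, h4]; simp

theorem crossedMul_one_right (h5 : CondC5 τ) (u : G →₀ R) :
    crossedMul c τ u (single 1 1) = u := by
  induction u using Finsupp.induction_linear with
  | zero => exact crossedMul_zero_left _
  | add u v hu hv => rw [crossedMul_add_left, hu, hv]
  | single g r => rw [crossedMul_single_single, h5]; simp

theorem crossedSMul_add_left (u v : G →₀ R) (z : G →₀ M) :
    crossedSMul c τ (u + v) z = crossedSMul c τ u z + crossedSMul c τ v z := by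
  unfold crossedSMul
  refine sum_add_index' (fun g => by simp) fun g r s => ?_
  simp [add_mul, add_smul, sum_add]

theorem crossedSMul_add_right (u : G →₀ R) (z z' : G →₀ M) :
    crossedSMul c τ u (z + z') = crossedSMul c τ u z + crossedSMul c τ u z' := by
  unfold crossedSMul
  rw [← sum_add]
  refine sum_congr fun g _ => sum_add_index' (fun h => by simp) fun h r s => ?_
  simp

theorem crossedSMul_single_single (g h : G) (r : R) (x : M) :
    crossedSMul c τ (single g r) (single h x) =
      single (g * h) ((c (g * h)).symm (r * (τ g h : R)) • x) := by
  simp [crossedSMul]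

theorem crossedSMul_zero_left (z : G →₀ M) : crossedSMul c τ 0 z = 0 := by
  simp [crossedSMul]

theorem crossedSMul_zero_right (u : G →₀ R) : crossedSMul c τ u (0 : G →₀ M) = 0 := by
  simp [crossedSMul]

variable (c τ) in
/-- The action of a fixed element of the crossed product, as an additive map. -/
noncomputable def crossedSMulHom (u : G →₀ R) : (G →₀ M) →+ (G →₀ M) :=
  AddMonoidHom.mk' (crossedSMul c τ u) (crossedSMul_add_right u)

@[simp]
theorem crossedSMulHom_apply (u : G →₀ R) (z : G →₀ M) :
    crossedSMulHom c τ u z = crossedSMul c τ u z := rfl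

theorem crossedMul_smul (h1 : CondC1 c τ) (h2 : CondC2 c τ) (u v : G →₀ R) (z : G →₀ M) :
    crossedSMul c τ (crossedMul c τ u v) z = crossedSMul c τ u (crossedSMul c τ v z) := by
  induction u using Finsupp.induction_linear with
  | zero => simp only [crossedMul_zero_left, crossedSMul_zero_left]
  | add u u' hu hu' => simp only [crossedMul_add_left, crossedSMul_add_left, hu, hu']
  | single g r =>
  induction v using Finsupp.induction_linear with
  | zero => simp only [crossedMul_zero_right, crossedSMul_zero_left, crossedSMul_zero_right]
  | add v v' hv hv' =>
    simp only [crossedMul_add_right, crossedSMul_add_left, crossedSMul_add_right, hv, hv']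
  | single h s =>
  induction z using Finsupp.induction_linear with
  | zero => simp only [crossedSMul_zero_right]
  | add w w' hw hw' => simp only [crossedSMul_add_right, hw, hw']
  | single k x =>
  simp only [crossedMul_single_single, crossedSMul_single_single, smul_smul, mul_assoc g h k]
  congr 2
  apply (c (g * (h * k))).injective
  rw [map_mul (c (g * (h * k))), RingEquiv.apply_symm_apply, RingEquiv.apply_symm_apply,
    mul_assoc r (τ g (h * k) : R), h1.mul_apply, RingEquiv.apply_symm_apply,
    mul_assoc _ (τ g h : R), h2, map_mul (c g)]
  simp only [mul_assoc]

theorem crossedSMul_single_one (h5 : CondC5 τ) (g : G) (r : R) (x : M) :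
    crossedSMul c τ (single g r) (single 1 x) = single g ((c g).symm r • x) := by
  simp [crossedSMul_single_single, h5 g]

theorem single_one_smul (h3 : CondC3 c) (h5 : CondC5 τ) (r : R) (x : M) :
    single (1 : G) (r • x) = crossedSMul c τ (single 1 r) (single 1 x) := by
  rw [crossedSMul_single_one h5, h3]; rfl

/-- Additive maps out of the induced module agree once they agree on pure tensors `u ⊗ x`. -/
theorem induced_addHom_ext {Q : Type*} [AddCommGroup Q] (h5 : CondC5 τ) {A B : (G →₀ M) →+ Q}
    (h : ∀ (u : G →₀ R) (x : M),
      A (crossedSMul c τ u (single 1 x)) = B (crossedSMul c τ u (single 1 x))) : A = B := by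
  refine addHom_ext fun g x => ?_
  simpa [crossedSMul_single_one h5] using h (single g 1) x

variable (τ) in
/-- The inverse in the crossed product of the basis element `1·g`. -/
noncomputable def basisInv (g : G) : G →₀ R :=
  single g⁻¹ (((τ g⁻¹ g)⁻¹ : Rˣ) : R)

theorem basis_mul_basisInv (h2 : CondC2 c τ) (h4 : CondC4 τ) (h5 : CondC5 τ) (g : G) :
    crossedMul c τ (single g 1) (basisInv τ g) = single 1 1 := by
  rw [basisInv, crossedMul_single_single, mul_inv_cancel]
  congr 1
  have := h2 g g⁻¹ g
  rw [mul_inv_cancel, inv_mul_cancel, h4, h5, Units.val_one, mul_one, mul_one] at this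
  rw [this, one_mul, ← map_mul, Units.inv_mul, map_one]

theorem basisInv_mul_basis (g : G) :
    crossedMul c τ (basisInv τ g) (single g 1) = single 1 1 := by
  simp [basisInv, crossedMul_single_single]

theorem basisInv_mul_single_one (h1 : CondC1 c τ) (h3 : CondC3 c) (h4 : CondC4 τ)
    (h5 : CondC5 τ) (g : G) (r : R) :
    crossedMul c τ (basisInv τ g) (single 1 (c g r)) =
      crossedMul c τ (single 1 r) (basisInv τ g) := by
  rw [basisInv, crossedMul_single_single, crossedMul_single_single, mul_one, one_mul, h5, h4]
  congr 1
  have := h1 g⁻¹ g r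
  rw [inv_mul_cancel, h3.apply_eq] at this
  simp [← this, h3.apply_eq, mul_assoc]

theorem basisInv_mul_basisInv (h1 : CondC1 c τ) (h2 : CondC2 c τ) (h3 : CondC3 c)
    (h4 : CondC4 τ) (h5 : CondC5 τ) (h k : G) :
    crossedMul c τ (basisInv τ k) (basisInv τ h) =
      crossedMul c τ (basisInv τ (h * k)) (single 1 (((τ h k)⁻¹ : Rˣ) : R)) := by
  set y := crossedMul c τ (basisInv τ (h * k)) (single 1 (((τ h k)⁻¹ : Rˣ) : R)) with hy
  have hleft : crossedMul c τ (crossedMul c τ y (single h 1)) (single k 1) = single 1 1 := by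
    have : crossedMul c τ (single 1 (((τ h k)⁻¹ : Rˣ) : R))
        (crossedMul c τ (single h 1) (single k 1)) = single (h * k) 1 := by
      rw [crossedMul_single_single, crossedMul_single_single, h4 (h * k), h3.apply_eq]
      simp
    rw [hy, crossedMul_assoc h1 h2, crossedMul_assoc h1 h2, this, basisInv_mul_basis]
  have : crossedMul c τ (crossedMul c τ (crossedMul c τ (crossedMul c τ y (single h 1))
      (single k 1)) (basisInv τ k)) (basisInv τ h) = y := by
    rw [crossedMul_assoc h1 h2 _ (single k 1), basis_mul_basisInv h2 h4 h5,
      crossedMul_one_right h5, crossedMul_assoc h1 h2, basis_mul_basisInv h2 h4 h5,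
      crossedMul_one_right h5]
  rw [← this, hleft, crossedMul_one_left h3 h4]

theorem isInducedHom_iff {φ : G → M → N} {A : (G →₀ M) → (G →₀ N)} :
    IsInducedHom c τ φ A ↔
      (∀ z z' : G →₀ M, A (z + z') = A z + A z') ∧
      (∀ (u : G →₀ R) (z : G →₀ M), A (crossedSMul c τ u z) = crossedSMul c τ u (A z)) ∧
      (∀ (u : G →₀ R) (x : M), A (crossedSMul c τ u (single 1 x)) =
        ∑ᶠ g : G, crossedSMul c τ (crossedMul c τ u (basisInv τ g)) (single 1 (φ g x))) :=
  Iff.rfl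

/-- A map with the additivity and the formula of `IsInducedHom` is automatically linear. -/
theorem isInducedHom_of_formula (h1 : CondC1 c τ) (h2 : CondC2 c τ) (h5 : CondC5 τ)
    {φ : G → M → N} (hφ : (Function.support φ).Finite) (A : (G →₀ M) →+ (G →₀ N))
    (hA : ∀ (u : G →₀ R) (x : M), A (crossedSMul c τ u (single 1 x)) =
      ∑ᶠ g : G, crossedSMul c τ (crossedMul c τ u (basisInv τ g)) (single 1 (φ g x))) :
    IsInducedHom c τ φ A := by
  refine isInducedHom_iff.2 ⟨map_add A, fun u z => ?_, hA⟩
  suffices A.comp (crossedSMulHom c τ u) = (crossedSMulHom c τ u).comp A from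
    DFunLike.congr_fun this z
  refine induced_addHom_ext (c := c) h5 fun v x => ?_
  simp only [AddMonoidHom.comp_apply, crossedSMulHom_apply]
  rw [← crossedMul_smul h1 h2, hA, hA, ← crossedSMulHom_apply u, AddMonoidHom.map_finsum]
  · simp only [crossedSMulHom_apply, ← crossedMul_smul h1 h2, crossedMul_assoc h1 h2]
  · refine hφ.subset fun g hg h0 => hg ?_
    simp [h0, crossedSMul_zero_right]

theorem IsInducedHom.unique (h5 : CondC5 τ) {φ : G → M → N} {A B : (G →₀ M) → (G →₀ N)}
    (hA : IsInducedHom c τ φ A) (hB : IsInducedHom c τ φ B) : A = B := by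
  have : AddMonoidHom.mk' A hA.1 = AddMonoidHom.mk' B hB.1 :=
    induced_addHom_ext (c := c) h5 fun u x => (hA.2.2 u x).trans (hB.2.2 u x).symm
  exact congrArg DFunLike.coe this

theorem exists_isInducedHom (h1 : CondC1 c τ) (h2 : CondC2 c τ) (h3 : CondC3 c)
    (h4 : CondC4 τ) (h5 : CondC5 τ) {φ : G → M → N} (hφ : (Function.support φ).Finite)
    (hadd : ∀ (g : G) (x y : M), φ g (x + y) = φ g x + φ g y)
    (hsemi : ∀ (g : G) (r : R) (x : M), φ g (r • x) = c g r • φ g x) :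
    ∃ A : (G →₀ M) → (G →₀ N), IsInducedHom c τ φ A := by
  let A : (G →₀ M) →+ (G →₀ N) := liftAddHom fun g => ∑ k ∈ hφ.toFinset,
    (crossedSMulHom c τ (crossedMul c τ (single g 1) (basisInv τ k))).comp
      ((singleAddHom 1).comp (AddMonoidHom.mk' (φ k) (hadd k)))
  have hA (g : G) (x : M) : A (single g x) = ∑ k ∈ hφ.toFinset,
      crossedSMul c τ (crossedMul c τ (single g 1) (basisInv τ k)) (single 1 (φ k x)) := by
    rw [liftAddHom_apply_single]
    simp
  refine ⟨A, isInducedHom_of_formula h1 h2 h5 hφ A fun u x => ?_⟩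
  rw [finsum_eq_sum_of_support_subset (s := hφ.toFinset)]
  · induction u using Finsupp.induction_linear with
    | zero => simp only [crossedSMul_zero_left, crossedMul_zero_left, map_zero,
        Finset.sum_const_zero]
    | add u v hu hv =>
      simp only [crossedSMul_add_left, crossedMul_add_left, map_add, hu, hv,
        Finset.sum_add_distrib]
    | single g r =>
      have hg : crossedMul c τ (single g 1) (single 1 ((c g).symm r)) = single g r := by
        simp [crossedMul_single_single, h5 g]
      rw [crossedSMul_single_one h5, hA]
      refine Finset.sum_congr rfl fun k _ => ?_
      rw [hsemi, single_one_smul h3 h5, ← crossedMul_smul h1 h2, crossedMul_assoc h1 h2,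
        basisInv_mul_single_one h1 h3 h4 h5, ← crossedMul_assoc h1 h2, hg]
  · intro g hg
    rw [Set.Finite.coe_toFinset]
    exact fun h0 => hg (by simp [h0, crossedSMul_zero_right])

theorem isInducedHom_id (h5 : CondC5 τ) {φ : G → M → M}
    (hone : φ 1 = id) (hne : ∀ g, g ≠ 1 → φ g = 0) : IsInducedHom c τ φ id := by
  refine isInducedHom_iff.2 ⟨fun _ _ => rfl, fun _ _ => rfl, fun u x => ?_⟩
  rw [finsum_eq_single _ 1 fun g hg => by simp [hne g hg, crossedSMul_zero_right]]
  simp [hone, basisInv, h5 1, crossedMul_one_right h5]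

/-- The composite family `χ_g(x) = Σ_{hk = g} τ(h,k)⁻¹·ψ_h(φ_k(x))`. -/
noncomputable def compFamily {X Y : Type*} (τ : G → G → Rˣ) (ψ : G → Y → P) (φ : G → X → Y)
    (g : G) (x : X) : P :=
  ∑ᶠ h : G, (((τ h (h⁻¹ * g))⁻¹ : Rˣ) : R) • ψ h (φ (h⁻¹ * g) x)

theorem compFamily_apply {X Y : Type*} {φ : G → X → Y} {ψ : G → Y → P}
    (hψ : (Function.support ψ).Finite) (g : G) (x : X) :
    compFamily τ ψ φ g x =
      ∑ h ∈ hψ.toFinset, (((τ h (h⁻¹ * g))⁻¹ : Rˣ) : R) • ψ h (φ (h⁻¹ * g) x) := by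
  refine finsum_eq_sum_of_support_subset _ fun h hh => ?_
  rw [Set.Finite.coe_toFinset]
  exact fun h0 => hh (by simp [h0])

theorem finite_support_compFamily {X Y : Type*} [AddCommGroup Y] {φ : G → X → Y} {ψ : G → Y → P}
    (hφ : (Function.support φ).Finite)
    (hψ : (Function.support ψ).Finite) (hψadd : ∀ (g : G) (x y : Y), ψ g (x + y) = ψ g x + ψ g y) :
    (Function.support (compFamily τ ψ φ)).Finite := by
  refine (hψ.mul hφ).subset fun g hg => ?_
  by_contra hnot
  refine hg (funext fun x => ?_)
  rw [compFamily_apply hψ]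
  refine Finset.sum_eq_zero fun h hh => ?_
  have h0 : φ (h⁻¹ * g) = 0 := by
    by_contra hk
    exact hnot ⟨h, by simpa using hh, h⁻¹ * g, hk, by simp⟩
  rw [h0, Pi.zero_apply, ← AddMonoidHom.mk'_apply (ψ h) (hψadd h), map_zero, smul_zero]

theorem compFamily_add {X Y : Type*} [AddCommGroup X] [AddCommGroup Y] {φ : G → X → Y}
    {ψ : G → Y → P} (hψ : (Function.support ψ).Finite)
    (hφadd : ∀ (g : G) (x y : X), φ g (x + y) = φ g x + φ g y)
    (hψadd : ∀ (g : G) (x y : Y), ψ g (x + y) = ψ g x + ψ g y) (g : G) (x y : X) :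
    compFamily τ ψ φ g (x + y) = compFamily τ ψ φ g x + compFamily τ ψ φ g y := by
  simp only [compFamily_apply hψ, hφadd, hψadd, smul_add, Finset.sum_add_distrib]

section

variable {φ : G → M → N} {ψ : G → N → P}

theorem compFamily_smul (h1 : CondC1 c τ) (hψ : (Function.support ψ).Finite)
    (hφsemi : ∀ (g : G) (r : R) (x : M), φ g (r • x) = c g r • φ g x)
    (hψsemi : ∀ (g : G) (r : R) (x : N), ψ g (r • x) = c g r • ψ g x)
    (g : G) (r : R) (x : M) :
    compFamily τ ψ φ g (r • x) = c g r • compFamily τ ψ φ g x := by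
  simp only [compFamily_apply hψ, hφsemi, hψsemi, Finset.smul_sum, smul_smul]
  refine Finset.sum_congr rfl fun h _ => ?_
  rw [← h1, mul_inv_cancel_left, ← mul_assoc, ← mul_assoc, Units.inv_mul, one_mul]

theorem IsInducedHom.comp (h1 : CondC1 c τ) (h2 : CondC2 c τ) (h3 : CondC3 c)
    (h4 : CondC4 τ) (h5 : CondC5 τ) (hφ : (Function.support φ).Finite)
    (hψ : (Function.support ψ).Finite) (hψadd : ∀ (g : G) (x y : N), ψ g (x + y) = ψ g x + ψ g y)
    {A : (G →₀ M) → (G →₀ N)} {B : (G →₀ N) → (G →₀ P)}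
    (hA : IsInducedHom c τ φ A) (hB : IsInducedHom c τ ψ B) :
    IsInducedHom c τ (compFamily τ ψ φ) (B ∘ A) := by
  rw [isInducedHom_iff] at hA hB ⊢
  obtain ⟨hAadd, hAsmul, hA⟩ := hA
  obtain ⟨hBadd, hBsmul, hB⟩ := hB
  refine ⟨fun z z' => by simp [hAadd, hBadd], fun u z => by simp [hAsmul, hBsmul],
    fun u x => ?_⟩
  have hψ0 (h : G) : ψ h 0 = 0 := map_zero (AddMonoidHom.mk' (ψ h) (hψadd h))
  let t (h k : G) : G →₀ P := crossedSMul c τ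
    (crossedMul c τ (crossedMul c τ u (basisInv τ k)) (basisInv τ h)) (single 1 (ψ h (φ k x)))
  have ht (h : G) : (Function.support (t h)).Finite := hφ.subset fun k hk h0 => hk (by
    simp [t, h0, hψ0, crossedSMul_zero_right])
  have hcomp : (B ∘ A) (crossedSMul c τ u (single 1 x)) =
      ∑ᶠ k, ∑ h ∈ hψ.toFinset, t h k := by
    rw [Function.comp_apply, hA, ← AddMonoidHom.mk'_apply B hBadd, AddMonoidHom.map_finsum]
    · refine finsum_congr fun k => ?_
      rw [AddMonoidHom.mk'_apply, hB]
      refine finsum_eq_sum_of_support_subset _ fun h hh => ?_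
      rw [Set.Finite.coe_toFinset]
      exact fun h0 => hh (by simp [h0, crossedSMul_zero_right])
    · exact hφ.subset fun k hk h0 => hk (by simp [h0, crossedSMul_zero_right])
  have hterm (g : G) : crossedSMul c τ (crossedMul c τ u (basisInv τ g))
      (single 1 (compFamily τ ψ φ g x)) = ∑ h ∈ hψ.toFinset, t h (h⁻¹ * g) := by
    rw [compFamily_apply hψ, ← singleAddHom_apply, map_sum, ← crossedSMulHom_apply, map_sum]
    refine Finset.sum_congr rfl fun h _ => ?_
    rw [singleAddHom_apply, crossedSMulHom_apply, single_one_smul h3 h5,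
      ← crossedMul_smul h1 h2, crossedMul_assoc h1 h2]
    dsimp only [t]
    rw [crossedMul_assoc h1 h2 u, basisInv_mul_basisInv h1 h2 h3 h4 h5, mul_inv_cancel_left]
  rw [hcomp, finsum_congr hterm, finsum_sum_comm _ _ fun h _ => ht h,
    finsum_sum_comm _ _ fun h _ => (ht h).preimage (mul_right_injective h⁻¹).injOn]
  exact Finset.sum_congr rfl fun h _ => (finsum_comp_equiv (Equiv.mulLeft h⁻¹)).symm

end

end CrossedProduct

open scoped Classical in
/-- under (C1)–(C5), with `S = R ∗_{c,τ} G` and `S ⊗_R M` the induced module,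
for a finitely supported family `φ = (φ_g)_{g ∈ G}` of additive `c_g`-semilinear maps
`φ_g : M → N`:
(a) there is a well-defined `S`-linear map `α(φ) : S ⊗_R M → S ⊗_R N` with
`α(φ)(u ⊗ x) = Σ_g u·(τ(g⁻¹,g)⁻¹·g⁻¹) ⊗ φ_g(x)` (and it is unique);
(b) if `φ_e = id` and `φ_g = 0` for `g ≠ e` then `α(φ) = id`;
(c) for a second finitely supported semilinear family `ψ = (ψ_h)`, the family
`χ_g(x) = Σ_{hk = g} τ(h,k)⁻¹·ψ_h(φ_k(x))` is a finitely supported family of additive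
`c_g`-semilinear maps and `α(χ) = α(ψ) ∘ α(φ)`. -/
theorem induced_hom_exists_id_comp
    (c : G → R ≃+* R) (τ : G → G → Rˣ)
    (h1 : CondC1 c τ) (h2 : CondC2 c τ) (h3 : CondC3 c) (h4 : CondC4 τ) (h5 : CondC5 τ)
    {M N P : Type w} [AddCommGroup M] [Module R M] [AddCommGroup N] [Module R N]
    [AddCommGroup P] [Module R P]
    (φ : G → M → N) (hφfin : (Function.support φ).Finite)
    (hφadd : ∀ (g : G) (x y : M), φ g (x + y) = φ g x + φ g y)
    (hφsemi : ∀ (g : G) (r : R) (x : M), φ g (r • x) = c g r • φ g x)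
    (ψ : G → N → P) (hψfin : (Function.support ψ).Finite)
    (hψadd : ∀ (g : G) (x y : N), ψ g (x + y) = ψ g x + ψ g y)
    (hψsemi : ∀ (g : G) (r : R) (x : N), ψ g (r • x) = c g r • ψ g x) :
    -- (a)
    (∃! A : (G →₀ M) → (G →₀ N), IsInducedHom c τ φ A) ∧
    -- (b)
    (∀ A : (G →₀ M) → (G →₀ M),
      IsInducedHom c τ (fun g x => if g = 1 then x else (0 : M)) A → ∀ z, A z = z) ∧
    -- (c)
    ((Function.support
        (fun g : G => fun x : M =>
          ∑ᶠ h : G, (((τ h (h⁻¹ * g))⁻¹ : Rˣ) : R) • ψ h (φ (h⁻¹ * g) x))).Finite ∧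
     (∀ (g : G) (x y : M),
        (∑ᶠ h : G, (((τ h (h⁻¹ * g))⁻¹ : Rˣ) : R) • ψ h (φ (h⁻¹ * g) (x + y))) =
          (∑ᶠ h : G, (((τ h (h⁻¹ * g))⁻¹ : Rˣ) : R) • ψ h (φ (h⁻¹ * g) x)) +
            ∑ᶠ h : G, (((τ h (h⁻¹ * g))⁻¹ : Rˣ) : R) • ψ h (φ (h⁻¹ * g) y)) ∧
     (∀ (g : G) (r : R) (x : M),
        (∑ᶠ h : G, (((τ h (h⁻¹ * g))⁻¹ : Rˣ) : R) • ψ h (φ (h⁻¹ * g) (r • x))) =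
          c g r • ∑ᶠ h : G, (((τ h (h⁻¹ * g))⁻¹ : Rˣ) : R) • ψ h (φ (h⁻¹ * g) x)) ∧
     (∀ (A : (G →₀ M) → (G →₀ N)) (B : (G →₀ N) → (G →₀ P)),
        IsInducedHom c τ φ A → IsInducedHom c τ ψ B →
        IsInducedHom c τ
          (fun g x => ∑ᶠ h : G, (((τ h (h⁻¹ * g))⁻¹ : Rˣ) : R) • ψ h (φ (h⁻¹ * g) x))
          (B ∘ A))) := by
  obtain ⟨A, hA⟩ := exists_isInducedHom h1 h2 h3 h4 h5 hφfin hφadd hφsemi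
  refine ⟨⟨A, hA, fun B hB => hB.unique h5 hA⟩, fun B hB z => ?_,
    finite_support_compFamily hφfin hψfin hψadd, compFamily_add hψfin hφadd hψadd,
    compFamily_smul h1 hψfin hφsemi hψsemi,
    fun A B hA hB => hA.comp h1 h2 h3 h4 h5 hφfin hψfin hψadd hB⟩
  have hid := isInducedHom_id (c := c) h5 (φ := fun g (x : M) => if g = 1 then x else 0)
    (by ext; simp) (fun g hg => by ext; simp [hg])
  exact congrFun (hB.unique h5 hid) z
end
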